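/- Let n be a positive integer. For every π ∈ NC^B(n) one has Kr(Abs(π)) = Abs(Kr(π)), where on the left Kr denotes the Kreweras complement on NC^A(n) and on the right Kr denotes the Kreweras complement on NC^B(n) (the restriction of the Kreweras complement of NC^A([±n]) to NC^B(n)). -/

import Mathlib

open scoped Classical

namespace NCPB

/-- A collection of subsets of `α` is a partition: blocks are nonempty and
every element lies in exactly one block. -/
def IsPartition {α : Type*} (P : Set (Set α)) : Prop :=
  (∀ B ∈ P, B.Nonempty) ∧ ∀ a : α, ∃! B, B ∈ P ∧ a ∈ B

/-- The non-crossing condition for a collection of subsets of a linear order: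
if `a < b < c < d`, `a, c` lie in a block `B` and `b, d` lie in a block `C`,
then `b ∈ B` (i.e. the blocks coincide). -/
def IsNC {α : Type*} [LinearOrder α] (P : Set (Set α)) : Prop :=
  ∀ B ∈ P, ∀ C ∈ P, ∀ a b c d : α, a < b → b < c → c < d →
    a ∈ B → c ∈ B → b ∈ C → d ∈ C → b ∈ B

/-- A non-crossing partition of a linear order. -/
def NCPart {α : Type*} [LinearOrder α] (P : Set (Set α)) : Prop :=
  IsPartition P ∧ IsNC P

/-- The set `[±m] = {1 < 2 < ... < m < -1 < -2 < ... < -m}` is encoded as `Fin (2*m)`,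
position `k < m` encoding `k+1` and position `m + j` encoding `-(j+1)`.
`negMap` is the inversion map `a ↦ -a`. -/
def negMap (m : ℕ) (k : Fin (2*m)) : Fin (2*m) :=
  ⟨(k.val + m) % (2*m), Nat.mod_lt _ (Nat.lt_of_le_of_lt (Nat.zero_le _) k.isLt)⟩

/-- Image of a subset of `[±m]` under the inversion map, i.e. `X ↦ -X`. -/
def negSet (m : ℕ) (X : Set (Fin (2*m))) : Set (Fin (2*m)) := negMap m '' X

/-- The absolute value map `[±m] → {1,...,m}`, `±i ↦ i`. -/
def absMap (m : ℕ) (k : Fin (2*m)) : Fin m :=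
  ⟨k.val % m, Nat.mod_lt _ (by have := k.isLt; omega)⟩

/-- A non-crossing partition of type B: a non-crossing partition of `[±m]`
invariant under the inversion map. -/
def NCBPart (m : ℕ) (π : Set (Set (Fin (2*m)))) : Prop :=
  NCPart π ∧ ∀ B ∈ π, negSet m B ∈ π

/-- The collection of sets `Abs(X)`, `X` a block of `π`. -/
def absPart (m : ℕ) (π : Set (Set (Fin (2*m)))) : Set (Set (Fin m)) :=
  {F | ∃ X ∈ π, F = absMap m '' X}

/-- The embedding of `{1,...,m}` onto the odd-indexed positions of the interleaved
set `1 < 1̄ < 2 < 2̄ < ... < m < m̄` (encoded as `Fin (2*m)`): `i ↦ i` (even positions). -/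
def evens (m : ℕ) (i : Fin m) : Fin (2*m) := ⟨2*i.val, by have := i.isLt; omega⟩

/-- The embedding of the barred copy `{1̄,...,m̄}` into the interleaved set: odd positions. -/
def odds (m : ℕ) (i : Fin m) : Fin (2*m) := ⟨2*i.val+1, by have := i.isLt; omega⟩

/-- `P` refines... rather: every block of `P` is contained in a block of `Q`
(the partial order on partitions by reverse refinement: `P ≤ Q`). -/
def Refines {α : Type*} (P Q : Set (Set α)) : Prop := ∀ B ∈ P, ∃ C ∈ Q, B ⊆ C

/-- The collection `p ∪ q̄` of subsets of the interleaved set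
`1 < 1̄ < 2 < 2̄ < ... < m < m̄`, with `p` living on the unbarred copy and `q` on the
barred copy. -/
def interleave (m : ℕ) (p q : Set (Set (Fin m))) : Set (Set (Fin (2*m))) :=
  ((fun B => evens m '' B) '' p) ∪ ((fun B => odds m '' B) '' q)

/-- `q` is the Kreweras complement of `p`: `q` is the largest non-crossing partition
(in the reverse-refinement order) such that `p ∪ q̄` is a non-crossing partition of the
interleaved set `1 < 1̄ < ... < m < m̄`. -/
def IsKr (m : ℕ) (p q : Set (Set (Fin m))) : Prop :=
  NCPart q ∧ NCPart (interleave m p q) ∧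
  ∀ q', NCPart q' → NCPart (interleave m p q') → Refines q' q

/-- Two sets cross: there are `a < b < c < d` with `a, c ∈ B` and `b, d ∈ C`. -/
def Crossing {α : Type*} [LinearOrder α] (B C : Set α) : Prop :=
  ∃ a b c d : α, a < b ∧ b < c ∧ c < d ∧ a ∈ B ∧ c ∈ B ∧ b ∈ C ∧ d ∈ C

/-- Two members of a non-crossing family of pairwise disjoint sets: disjoint,
and neither crosses the other. -/
def PairNC {α : Type*} [LinearOrder α] (B C : Set α) : Prop :=
  Disjoint B C ∧ ¬ Crossing B C ∧ ¬ Crossing C B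

end NCPB
namespace NCPB

/-- `i` and `j` are not separated by a block of `p`: the interval between them, open at its
lower and closed at its upper end, is a union of blocks of `p`. -/
def Unseparated {m : ℕ} (p : Set (Set (Fin m))) (i j : Fin m) : Prop :=
  ∀ B ∈ p, ∀ x ∈ B, ∀ y ∈ B, ((x ≤ i ↔ x ≤ j) ↔ (y ≤ i ↔ y ≤ j))

namespace Unseparated

variable {m : ℕ} {p : Set (Set (Fin m))} {i j k : Fin m}

theorem refl (p : Set (Set (Fin m))) (i : Fin m) : Unseparated p i i :=
  fun _ _ _ _ _ _ => by tauto

theorem symm (h : Unseparated p i j) : Unseparated p j i := by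
  intro B hB x hx y hy
  have := h B hB x hx y hy
  tauto

theorem trans (h : Unseparated p i j) (h' : Unseparated p j k) : Unseparated p i k := by
  intro B hB x hx y hy
  have h₁ := h B hB x hx y hy
  have h₂ := h' B hB x hx y hy
  tauto

theorem of_le (hij : i ≤ j)
    (h : ∀ B ∈ p, ∀ x ∈ B, ∀ y ∈ B, i < x → x ≤ j → i < y ∧ y ≤ j) : Unseparated p i j := by
  intro B hB x hx y hy
  have h₁ := h B hB x hx y hy
  have h₂ := h B hB y hy x hx
  omega

end Unseparated

/-- The partition of `Fin m` into classes of unseparated points. -/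
def unseparatedClasses {m : ℕ} (p : Set (Set (Fin m))) : Set (Set (Fin m)) :=
  {B | ∃ i, B = {j | Unseparated p i j}}

theorem ncPart_unseparatedClasses {m : ℕ} (p : Set (Set (Fin m))) :
    NCPart (unseparatedClasses p) := by
  refine ⟨⟨?_, fun a => ⟨{j | Unseparated p a j}, ⟨⟨a, rfl⟩, .refl p a⟩, ?_⟩⟩, ?_⟩
  · rintro _ ⟨i, rfl⟩
    exact ⟨i, .refl p i⟩
  · rintro _ ⟨⟨i, rfl⟩, hi : Unseparated p i a⟩
    ext j
    exact ⟨hi.symm.trans, hi.trans⟩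
  · rintro _ ⟨i, rfl⟩ _ ⟨j, rfl⟩ a b c d hab hbc hcd (ha : Unseparated p i a)
      (hc : Unseparated p i c) (hb : Unseparated p j b) (hd : Unseparated p j d)
    refine ha.trans (.of_le hab.le ?_)
    intro B hB x hx y hy
    have h₁ := (ha.symm.trans hc) B hB x hx y hy
    have h₂ := (hb.symm.trans hd) B hB x hx y hy
    omega

theorem unseparated_of_isNC_interleave {m : ℕ} {p q : Set (Set (Fin m))}
    (h : IsNC (interleave m p q)) {B : Set (Fin m)} (hB : B ∈ q) {i j : Fin m}
    (hi : i ∈ B) (hj : j ∈ B) : Unseparated p i j := by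
  wlog hij : i ≤ j generalizing i j
  · exact (this hj hi (le_of_not_ge hij)).symm
  refine .of_le hij fun D hD x hx y hy hix hxj => ?_
  have hD' : evens m '' D ∈ interleave m p q := .inl ⟨D, hD, rfl⟩
  have hB' : odds m '' B ∈ interleave m p q := .inr ⟨B, hB, rfl⟩
  by_contra hcon
  rcases lt_or_ge j y with hy' | hy'
  · obtain ⟨z, -, hz⟩ := h _ hB' _ hD' (odds m i) (evens m x) (odds m j) (evens m y)
      (by simp only [odds, evens, Fin.mk_lt_mk]; omega)
      (by simp only [odds, evens, Fin.mk_lt_mk]; omega)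
      (by simp only [odds, evens, Fin.mk_lt_mk]; omega)
      ⟨i, hi, rfl⟩ ⟨j, hj, rfl⟩ ⟨x, hx, rfl⟩ ⟨y, hy, rfl⟩
    simp only [odds, evens, Fin.mk.injEq] at hz
    omega
  · obtain ⟨z, -, hz⟩ := h _ hD' _ hB' (evens m y) (odds m i) (evens m x) (odds m j)
      (by simp only [odds, evens, Fin.mk_lt_mk]; omega)
      (by simp only [odds, evens, Fin.mk_lt_mk]; omega)
      (by simp only [odds, evens, Fin.mk_lt_mk]; omega)
      ⟨y, hy, rfl⟩ ⟨x, hx, rfl⟩ ⟨i, hi, rfl⟩ ⟨j, hj, rfl⟩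
    simp only [odds, evens, Fin.mk.injEq] at hz
    omega

theorem ncPart_interleave_unseparatedClasses {m : ℕ} {p q : Set (Set (Fin m))}
    (h : NCPart (interleave m p q)) : NCPart (interleave m p (unseparatedClasses p)) := by
  obtain ⟨⟨hne, hex⟩, hnc⟩ := h
  obtain ⟨⟨hne', hex'⟩, hnc'⟩ := ncPart_unseparatedClasses p
  have hparity : ∀ i j, evens m i ≠ odds m j := by
    intro i j h
    simp only [odds, evens, Fin.mk.injEq] at h
    omega
  have hodds : Function.Injective (odds m) := by
    intro i j h
    simp only [odds, Fin.mk.injEq] at h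
    omega
  refine ⟨⟨?_, fun a => ?_⟩, ?_⟩
  · rintro _ (⟨B, hB, rfl⟩ | ⟨B, hB, rfl⟩)
    · exact hne _ (.inl ⟨B, hB, rfl⟩)
    · exact (hne' B hB).image _
  · rcases Nat.even_or_odd' a.val with ⟨k, hk | hk⟩
    · obtain ⟨i, rfl⟩ : ∃ i, a = evens m i := ⟨⟨k, by omega⟩, Fin.ext hk⟩
      obtain ⟨D, ⟨hD, hiD⟩, huniq⟩ := hex (evens m i)
      refine ⟨D, ⟨?_, hiD⟩, ?_⟩
      · rcases hD with hD | ⟨B, -, rfl⟩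
        · exact .inl hD
        · obtain ⟨j, -, hj⟩ := hiD
          exact absurd hj.symm (hparity i j)
      · rintro _ ⟨hE | ⟨B, -, rfl⟩, hiE⟩
        · exact huniq _ ⟨.inl hE, hiE⟩
        · obtain ⟨j, -, hj⟩ := hiE
          exact absurd hj.symm (hparity i j)
    · obtain ⟨i, rfl⟩ : ∃ i, a = odds m i := ⟨⟨k, by omega⟩, Fin.ext hk⟩
      obtain ⟨D, ⟨hD, hiD⟩, huniq⟩ := hex' i
      refine ⟨odds m '' D, ⟨.inr ⟨D, hD, rfl⟩, i, hiD, rfl⟩, ?_⟩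
      rintro _ ⟨⟨B, -, rfl⟩ | ⟨B, hB, rfl⟩, hiE⟩
      · obtain ⟨j, -, hj⟩ := hiE
        exact absurd hj (hparity j i)
      · exact congrArg (odds m '' ·) (huniq B ⟨hB, (hodds.mem_set_image).1 hiE⟩)
  · rintro _ (⟨B, hB, rfl⟩ | ⟨B, hB, rfl⟩) _ (⟨C, hC, rfl⟩ | ⟨C, hC, rfl⟩)
    · exact hnc _ (.inl ⟨B, hB, rfl⟩) _ (.inl ⟨C, hC, rfl⟩)
    · rintro _ _ _ _ hab hbc hcd ⟨a, ha, rfl⟩ ⟨c, hc, rfl⟩ ⟨b, hb, rfl⟩ ⟨d, hd, rfl⟩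
      obtain ⟨i, rfl⟩ := hC
      have := (Unseparated.trans (.symm hb) hd) B hB a ha c hc
      simp only [odds, evens, Fin.mk_lt_mk] at hab hbc hcd
      omega
    · rintro _ _ _ _ hab hbc hcd ⟨a, ha, rfl⟩ ⟨c, hc, rfl⟩ ⟨b, hb, rfl⟩ ⟨d, hd, rfl⟩
      obtain ⟨i, rfl⟩ := hB
      have := (Unseparated.trans (.symm ha) hc) C hC b hb d hd
      simp only [odds, evens, Fin.mk_lt_mk] at hab hbc hcd
      omega
    · rintro _ _ _ _ hab hbc hcd ⟨a, ha, rfl⟩ ⟨c, hc, rfl⟩ ⟨b, hb, rfl⟩ ⟨d, hd, rfl⟩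
      simp only [odds, Fin.mk_lt_mk] at hab hbc hcd
      exact ⟨b, hnc' B hB C hC a b c d (by omega) (by omega) (by omega) ha hc hb hd, rfl⟩

/-- Two points lie in the same block of the Kreweras complement of `p` if and only if no block
of `p` separates them. -/
theorem IsKr.mem_iff {m : ℕ} {p q : Set (Set (Fin m))} (h : IsKr m p q) {B : Set (Fin m)}
    (hB : B ∈ q) {i : Fin m} (hi : i ∈ B) (j : Fin m) : j ∈ B ↔ Unseparated p i j := by
  refine ⟨unseparated_of_isNC_interleave h.2.1.2 hB hi, fun hij => ?_⟩
  obtain ⟨C, hC, hsub⟩ := h.2.2 _ (ncPart_unseparatedClasses p)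
    (ncPart_interleave_unseparatedClasses h.2.1) _ ⟨i, rfl⟩
  have hBC : B = C := (h.1.1.2 i).unique ⟨hB, hi⟩ ⟨hC, hsub (.refl p i)⟩
  exact hBC ▸ hsub hij

theorem negMap_val {n : ℕ} (x : Fin (2 * n)) :
    (x.val < n ∧ (negMap n x).val = x.val + n) ∨ (n ≤ x.val ∧ (negMap n x).val + n = x.val) := by
  have hx := x.isLt
  rcases lt_or_ge x.val n with h | h
  · exact .inl ⟨h, Nat.mod_eq_of_lt (by omega)⟩
  · refine .inr ⟨h, ?_⟩
    simp only [negMap]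
    rw [Nat.mod_eq_sub_mod (by omega), Nat.mod_eq_of_lt (by omega)]
    omega

theorem absMap_val {n : ℕ} (x : Fin (2 * n)) :
    (x.val < n ∧ (absMap n x).val = x.val) ∨ (n ≤ x.val ∧ (absMap n x).val + n = x.val) := by
  have hx := x.isLt
  rcases lt_or_ge x.val n with h | h
  · exact .inl ⟨h, Nat.mod_eq_of_lt h⟩
  · refine .inr ⟨h, ?_⟩
    simp only [absMap]
    rw [Nat.mod_eq_sub_mod h, Nat.mod_eq_of_lt (by omega)]
    omega

theorem absMap_negMap {n : ℕ} (x : Fin (2 * n)) : absMap n (negMap n x) = absMap n x := by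
  have := negMap_val x
  have := absMap_val x
  have := absMap_val (negMap n x)
  omega

theorem negMap_negMap {n : ℕ} (x : Fin (2 * n)) : negMap n (negMap n x) = x := by
  have := negMap_val x
  have := negMap_val (negMap n x)
  omega

section TypeB

variable {n : ℕ} {π : Set (Set (Fin (2 * n)))}

theorem Unseparated.map_negMap (hπ : ∀ B ∈ π, negSet n B ∈ π) {a b : Fin (2 * n)}
    (h : Unseparated π a b) : Unseparated π (negMap n a) (negMap n b) := by
  intro B hB x hx y hy
  have := h _ (hπ B hB) _ ⟨x, hx, rfl⟩ _ ⟨y, hy, rfl⟩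
  have := negMap_val a
  have := negMap_val b
  have := negMap_val x
  have := negMap_val y
  simp only [Fin.le_def] at *
  omega

theorem Unseparated.map_absMap (hπ : ∀ B ∈ π, negSet n B ∈ π) {a b : Fin (2 * n)}
    (h : Unseparated π a b) : Unseparated (absPart n π) (absMap n a) (absMap n b) := by
  rintro _ ⟨B, hB, rfl⟩ _ ⟨x, hx, rfl⟩ _ ⟨y, hy, rfl⟩
  have := h B hB x hx y hy
  have := h.map_negMap hπ B hB x hx y hy
  have := negMap_val a
  have := negMap_val b
  have := absMap_val a
  have := absMap_val b
  have := absMap_val x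
  have := absMap_val y
  simp only [Fin.le_def] at *
  omega

/-- Points of `[±n]` whose absolute values are not separated by `Abs(π)` are themselves, up to
sign, not separated by `π`. -/
theorem Unseparated.of_map_absMap (hπ : NCBPart n π) {a b : Fin (2 * n)}
    (h : Unseparated (absPart n π) (absMap n a) (absMap n b)) :
    Unseparated π a b ∨ Unseparated π a (negMap n b) := by
  have hneg {a b : Fin (2 * n)} (h : Unseparated π a (negMap n b)) :
      Unseparated π (negMap n a) b := by
    simpa only [negMap_negMap] using h.map_negMap hπ.2
  wlog ha : a.val < n generalizing a
  · have hna := negMap_val a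
    rcases @this (negMap n a) (by rwa [absMap_negMap]) (by omega) with h | h
    · exact .inr (by simpa only [negMap_negMap] using h.map_negMap hπ.2)
    · exact .inl (by simpa only [negMap_negMap] using h.map_negMap hπ.2)
  wlog hb : b.val < n generalizing b
  · have hnb := negMap_val b
    rcases @this (negMap n b) (by rwa [absMap_negMap]) (by omega) with h | h
    · exact .inr h
    · exact .inl (by simpa only [negMap_negMap] using h)
  wlog hab : a ≤ b generalizing a b
  · rcases this hb h.symm ha (le_of_not_ge hab) with h | h
    · exact .inl h.symm
    · exact .inr (hneg h).symm
  have hsep : ∀ B ∈ π, ∀ x ∈ B, ∀ y ∈ B,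
      ((a < x ∧ x ≤ b ∨ a.val + n < x ∧ x ≤ b.val + n) ↔
        (a < y ∧ y ≤ b ∨ a.val + n < y ∧ y ≤ b.val + n)) := by
    intro B hB x hx y hy
    have := h _ ⟨B, hB, rfl⟩ _ ⟨x, hx, rfl⟩ _ ⟨y, hy, rfl⟩
    have := absMap_val a
    have := absMap_val b
    have := absMap_val x
    have := absMap_val y
    simp only [Fin.le_def, Fin.lt_def] at *
    omega
  have hna := negMap_val a
  by_contra hcon
  rw [not_or] at hcon
  obtain ⟨hU, hV⟩ := hcon
  replace hV : ¬ Unseparated π b (negMap n a) := fun h => hV <| by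
    simpa only [negMap_negMap] using (h.map_negMap hπ.2).symm
  have hU' := mt (Unseparated.of_le hab) hU
  have hV' := mt (Unseparated.of_le (by omega)) hV
  push Not at hU' hV'
  obtain ⟨B, hB, x, hx, y, hy, hax, hxb, hyU⟩ := hU'
  obtain ⟨C, hC, z, hz, w, hw, hbz, hza, hwV⟩ := hV'
  have hxy := hsep B hB x hx y hy
  have hzw := hsep C hC z hz w hw
  rcases lt_or_ge a w with haw | haw
  · have := hsep B hB x hx z (hπ.1.2 B hB C hC x z y w (by omega) (by omega) (by omega)
      hx hy hz hw)
    omega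
  · have := hsep C hC x (hπ.1.2 C hC B hB w x z y (by omega) (by omega) (by omega)
      hw hz hx hy) z hz
    omega

end TypeB

theorem IsKr.eq_image_absMap {n : ℕ} {π ρ : Set (Set (Fin (2 * n)))} {q : Set (Set (Fin n))}
    (hρ : IsKr (2 * n) π ρ) (hπ : NCBPart n π) (hq : IsKr n (absPart n π) q)
    {X : Set (Fin (2 * n))} (hX : X ∈ ρ) {a : Fin (2 * n)} (ha : a ∈ X)
    {C : Set (Fin n)} (hC : C ∈ q) (haC : absMap n a ∈ C) : C = absMap n '' X := by
  ext j
  rw [hq.mem_iff hC haC]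
  constructor
  · intro h
    have hj := j.isLt
    obtain ⟨b, rfl⟩ : ∃ b, absMap n b = j :=
      ⟨⟨j, by omega⟩, Fin.ext (Nat.mod_eq_of_lt hj)⟩
    rcases h.of_map_absMap hπ with h | h
    · exact ⟨b, (hρ.mem_iff hX ha b).2 h, rfl⟩
    · exact ⟨_, (hρ.mem_iff hX ha _).2 h, absMap_negMap b⟩
  · rintro ⟨b, hb, rfl⟩
    exact ((hρ.mem_iff hX ha b).1 hb).map_absMap hπ.2

end NCPB

open NCPB in
/-- `Kr(Abs(π)) = Abs(Kr(π))` for `π ∈ NC^B(n)`: if `ρ` is the Kreweras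
complement of `π` (taken in `NC^A([±n])`, which restricts to the Kreweras complement on
`NC^B(n)`) and `q` is the Kreweras complement of `Abs(π)` in `NC^A(n)`, then
`q = Abs(ρ)`. -/
theorem kr_absPart_eq_absPart_kr (n : ℕ) (hn : 0 < n)
    (π ρ : Set (Set (Fin (2*n)))) (hπ : NCBPart n π) (hρ : IsKr (2*n) π ρ)
    (q : Set (Set (Fin n))) (hq : IsKr n (absPart n π) q) :
    q = absPart n ρ := by
  ext C
  constructor
  · intro hC
    obtain ⟨i, hi⟩ := hq.1.1.1 C hC
    have hin := i.isLt
    obtain ⟨a, rfl⟩ : ∃ a, absMap n a = i :=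
      ⟨⟨i, by omega⟩, Fin.ext (Nat.mod_eq_of_lt hin)⟩
    obtain ⟨X, ⟨hX, ha⟩, -⟩ := hρ.1.1.2 a
    exact ⟨X, hX, hρ.eq_image_absMap hπ hq hX ha hC hi⟩
  · rintro ⟨X, hX, rfl⟩
    obtain ⟨a, ha⟩ := hρ.1.1.1 X hX
    obtain ⟨C, ⟨hC, haC⟩, -⟩ := hq.1.1.2 (absMap n a)
    exact hρ.eq_image_absMap hπ hq hX ha hC haC ▸ hC
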